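/- Exploding differences for fractionally related polynomials: In the homogeneous decomposition setup, suppose R_k(y) = 0 for all y ∈ [0,1] and that there exist coprime positive integers a > b, with integers α_b,…,α_a satisfying |α_b| = 1, such that γ_k(y)^a = Σ_{j=b}^a α_j y^j for all y ∈ [0,1]. Let s ≤ k−1 be such that C_u is identically zero on [0,1] for every 2 ≤ u ≤ s, and suppose a < s. Then q and p have exploding differences. -/

import Mathlib

noncomputable section

/-- Evaluation of a bivariate polynomial (outer variable `n`, inner variable `N`). -/
def bEval (Q : Polynomial (Polynomial ℕ)) (n N : ℕ) : ℕ :=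
  (Q.map (Polynomial.evalRingHom N)).eval n

/-- The degree of a bivariate polynomial `q(x,y)`, defined as the degree of `q(x,x)`. -/
def diagDeg (Q : Polynomial (Polynomial ℕ)) : ℕ :=
  (Q.eval Polynomial.X).natDegree

/-- The homogeneous component `Q_u` of a bivariate polynomial:
`q(n,N) = Σ_u N^u Q_u(n/N)` with `deg Q_u ≤ u`. -/
def homComp (Q : Polynomial (Polynomial ℕ)) (u : ℕ) : Polynomial ℝ :=
  ∑ s ∈ Finset.range (u + 1),
    Polynomial.C (((Q.coeff s).coeff (u - s) : ℝ)) * Polynomial.X ^ s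

/-- Two bivariate polynomials (given by their evaluations) have *exploding
differences*. -/
def ExplodingDiff (q p : ℕ → ℕ → ℕ) : Prop :=
  ∀ δ : ℝ, 0 < δ → δ < 1 →
    ∃ C : ℝ, 0 < C ∧ ∃ N₀ : ℕ, ∃ Γ : ℕ → Finset ℕ,
      (∀ N : ℕ, ((Γ N).card : ℝ) ≤ δ * N) ∧ (∀ N : ℕ, ↑(Γ N) ⊆ Set.Icc 1 N) ∧
      ∀ N : ℕ, N₀ < N → ∀ n : ℕ, δ * N ≤ (n : ℝ) → n ≤ N → n ∉ Γ N →
        ∀ m : ℕ, δ * N ≤ (m : ℝ) → m ≤ N →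
          C * N ≤ |(q m N : ℝ) - (p n N : ℝ)|



lemma coeff_zero_of_deg (Q : Polynomial (Polynomial ℕ)) (s t : ℕ) (h : diagDeg Q < s + t) :
    (Q.coeff s).coeff t = 0 := by
  by_contra hne
  have h1 : (Q.eval Polynomial.X).coeff (s + t) = 0 :=
    Polynomial.coeff_eq_zero_of_natDegree_lt h
  rw [Polynomial.eval_eq_sum_range, Polynomial.finsetSum_coeff, Finset.sum_eq_zero_iff] at h1
  have hs : s ∈ Finset.range (Q.natDegree + 1) := by
    rw [Finset.mem_range, Nat.lt_succ_iff]
    apply Polynomial.le_natDegree_of_ne_zero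
    intro h0
    rw [h0] at hne
    simp at hne
  have h2 := h1 s hs
  rw [add_comm s t, Polynomial.coeff_mul_X_pow] at h2
  exact hne h2

lemma bEval_eq (Q : Polynomial (Polynomial ℕ)) (k : ℕ) (hd : diagDeg Q = k) (n N : ℕ)
    (hN : 0 < N) :
    (bEval Q n N : ℝ) = ∑ u ∈ Finset.range (k + 1),
      (N : ℝ) ^ u * (homComp Q u).eval ((n : ℝ) / N) := by
  have hQ : Q.natDegree < k + 1 := by
    rw [Nat.lt_succ_iff, Polynomial.natDegree_le_iff_coeff_eq_zero]
    intro s hs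
    ext t
    rw [coeff_zero_of_deg Q s t (by omega)]
    simp
  have hq : ∀ s ∈ Finset.range (k + 1), (Q.coeff s).natDegree < k + 1 - s := by
    intro s hs
    rw [Finset.mem_range] at hs
    have : (Q.coeff s).natDegree ≤ k - s := by
      rw [Polynomial.natDegree_le_iff_coeff_eq_zero]
      intro t ht
      exact coeff_zero_of_deg Q s t (by omega)
    omega
  have h1 : (bEval Q n N : ℝ) = ∑ s ∈ Finset.range (k + 1), ∑ t ∈ Finset.range (k + 1 - s),
      ((Q.coeff s).coeff t : ℝ) * (N : ℝ) ^ t * (n : ℝ) ^ s := by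
    unfold bEval
    rw [Polynomial.eval_map, Polynomial.eval₂_eq_sum_range' _ hQ]
    push_cast
    refine Finset.sum_congr rfl fun s hs => ?_
    rw [Polynomial.coe_evalRingHom, Polynomial.eval_eq_sum_range' (hq s hs)]
    push_cast
    rw [Finset.sum_mul]
  rw [h1, ← Finset.sum_range_diag_flip]
  refine Finset.sum_congr rfl fun u _ => ?_
  unfold homComp
  rw [Polynomial.eval_finsetSum, Finset.mul_sum]
  refine Finset.sum_congr rfl fun s hs => ?_
  have hs' : s ≤ u := by rw [Finset.mem_range] at hs; omega
  simp only [Polynomial.eval_mul, Polynomial.eval_C, Polynomial.eval_pow, Polynomial.eval_X]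
  obtain ⟨t, rfl⟩ := Nat.exists_eq_add_of_le hs'
  have : (N : ℝ) ≠ 0 := by positivity
  rw [Nat.add_sub_cancel_left, div_pow, pow_add]
  field_simp

lemma homComp_eval (Q : Polynomial (Polynomial ℕ)) (u : ℕ) (x : ℝ) :
    (homComp Q u).eval x = ∑ s ∈ Finset.range (u + 1), ((Q.coeff s).coeff (u - s) : ℝ) * x ^ s := by
  unfold homComp
  rw [Polynomial.eval_finsetSum]
  simp

lemma homComp_mono (Q : Polynomial (Polynomial ℕ)) (u : ℕ) {x y : ℝ} (hx : 0 ≤ x) (hxy : x ≤ y) :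
    (homComp Q u).eval x ≤ (homComp Q u).eval y := by
  rw [homComp_eval, homComp_eval]
  gcongr

lemma homComp_nonneg (Q : Polynomial (Polynomial ℕ)) (u : ℕ) {x : ℝ} (hx : 0 ≤ x) :
    0 ≤ (homComp Q u).eval x := by
  rw [homComp_eval]
  positivity

lemma exists_coeff (Q : Polynomial (Polynomial ℕ)) (u : ℕ) (h : (homComp Q u).natDegree ≠ 0) :
    ∃ i ∈ Finset.range (u + 1), i ≠ 0 ∧ (1 : ℝ) ≤ ((Q.coeff i).coeff (u - i) : ℝ) := by
  by_contra hcon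
  push Not at hcon
  apply h
  rw [← Nat.le_zero]
  unfold homComp
  apply Polynomial.natDegree_sum_le_of_forall_le
  intro s hs
  by_cases h0 : s = 0
  · subst h0; simp
  · have h1 := hcon s hs h0
    have h2 : (Q.coeff s).coeff (u - s) < 1 := by exact_mod_cast h1
    have h3 : (Q.coeff s).coeff (u - s) = 0 := by omega
    rw [h3]; simp

lemma homComp_lower (Q : Polynomial (Polynomial ℕ)) (k : ℕ) (h : (homComp Q k).natDegree ≠ 0)
    (δ : ℝ) (hδ : 0 < δ) : ∃ c : ℝ, 0 < c ∧ ∀ u v : ℝ, 0 ≤ u → u ≤ v → δ ≤ v →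
      c * (v - u) ≤ (homComp Q k).eval v - (homComp Q k).eval u := by
  obtain ⟨i, hi, hi0, hc⟩ := exists_coeff Q k h
  refine ⟨δ ^ (i - 1), by positivity, fun u v hu huv hv => ?_⟩
  rw [homComp_eval, homComp_eval, ← Finset.sum_sub_distrib]
  have key : δ ^ (i - 1) * (v - u) ≤ v ^ i - u ^ i := by
    obtain ⟨j, rfl⟩ := Nat.exists_eq_succ_of_ne_zero hi0
    simp only [Nat.succ_eq_add_one, Nat.add_sub_cancel]
    have h1 : δ ^ j ≤ v ^ j := by gcongr
    have h2 : u ^ j ≤ v ^ j := by gcongr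
    rw [pow_succ, pow_succ]
    nlinarith [mul_le_mul_of_nonneg_right h1 (sub_nonneg.2 huv), mul_le_mul_of_nonneg_right h2 hu]
  have hn : ∀ s, 0 ≤ v ^ s - u ^ s := fun s => sub_nonneg.2 (by gcongr)
  calc δ ^ (i - 1) * (v - u) ≤ v ^ i - u ^ i := key
    _ ≤ ((Q.coeff i).coeff (k - i) : ℝ) * v ^ i - ((Q.coeff i).coeff (k - i) : ℝ) * u ^ i := by
        rw [← mul_sub]; exact le_mul_of_one_le_left (hn i) hc
    _ ≤ _ := Finset.single_le_sum (f := fun s => ((Q.coeff s).coeff (k - s) : ℝ) * v ^ s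
          - ((Q.coeff s).coeff (k - s) : ℝ) * u ^ s)
          (fun s _ => by rw [← mul_sub]; exact mul_nonneg (by positivity) (hn s)) hi

lemma homComp_deriv_pos (Q : Polynomial (Polynomial ℕ)) (k : ℕ) (h : (homComp Q k).natDegree ≠ 0)
    (x : ℝ) (hx : 0 < x) : 0 < (homComp Q k).derivative.eval x := by
  obtain ⟨i, hi, hi0, hc⟩ := exists_coeff Q k h
  unfold homComp
  rw [Polynomial.derivative_sum, Polynomial.eval_finsetSum]
  apply Finset.sum_pos'
  · intro s _
    simp only [Polynomial.derivative_C_mul_X_pow, Polynomial.eval_mul, Polynomial.eval_C,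
      Polynomial.eval_pow, Polynomial.eval_X]
    positivity
  · refine ⟨i, hi, ?_⟩
    simp only [Polynomial.derivative_C_mul_X_pow, Polynomial.eval_mul, Polynomial.eval_C,
      Polynomial.eval_pow, Polynomial.eval_X]
    have : (0 : ℝ) < ((Q.coeff i).coeff (k - i) : ℝ) := by linarith
    have : (0 : ℝ) < i := by exact_mod_cast Nat.pos_of_ne_zero hi0
    positivity

lemma perfect_power (a b : ℕ) (hba : b < a) (hcop : Nat.Coprime a b)
    (α : ℕ → ℤ) (hαb : |α b| = 1) (m n N : ℕ) (hn : 0 < n)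
    (h : (m : ℤ) ^ a = ∑ j ∈ Finset.Icc b a, α j * (n : ℤ) ^ j * (N : ℤ) ^ (a - j)) :
    ∃ d t : ℕ, d ∣ N ∧ n = d * t ^ a := by
  obtain ⟨n', N', hco, hn', hN'⟩ := Nat.exists_coprime n N
  set d := Nat.gcd n N with hd
  have hdpos : 0 < d := Nat.gcd_pos_of_pos_left _ hn
  set B : ℤ := ∑ j ∈ Finset.Icc b a, α j * (n' : ℤ) ^ (j - b) * (N' : ℤ) ^ (a - j) with hB
  have h1 : (m : ℤ) ^ a = (d : ℤ) ^ a * ((n' : ℤ) ^ b * B) := by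
    rw [h, hB, Finset.mul_sum, Finset.mul_sum]
    refine Finset.sum_congr rfl fun j hj => ?_
    rw [Finset.mem_Icc] at hj
    rw [hn', hN']
    push_cast
    rw [mul_pow, mul_pow]
    have e1 : (n' : ℤ) ^ j = (n' : ℤ) ^ b * (n' : ℤ) ^ (j - b) := by
      rw [← pow_add]; congr 1; omega
    have e2 : (d : ℤ) ^ a = (d : ℤ) ^ j * (d : ℤ) ^ (a - j) := by
      rw [← pow_add]; congr 1; omega
    rw [e1, e2]; ring
  have h2 : d ∣ m := by
    have : (d : ℤ) ^ a ∣ (m : ℤ) ^ a := ⟨_, h1⟩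
    have h3 : d ^ a ∣ m ^ a := by exact_mod_cast this
    exact (Nat.pow_dvd_pow_iff (by omega)).1 h3
  obtain ⟨m', rfl⟩ := h2
  have h3 : (m' : ℤ) ^ a = (n' : ℤ) ^ b * B := by
    push_cast at h1
    rw [mul_pow] at h1
    exact mul_left_cancel₀ (by positivity) h1
  have h4 : n' ^ b * B.natAbs = m' ^ a := by
    have := congrArg Int.natAbs h3
    simp only [Int.natAbs_mul, Int.natAbs_pow, Int.natAbs_natCast] at this
    exact this.symm
  have h5 : IsCoprime (n' : ℤ) B := by
    have hB2 : B = α b * (N' : ℤ) ^ (a - b) + (n' : ℤ) *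
        ∑ j ∈ Finset.Ioc b a, α j * (n' : ℤ) ^ (j - b - 1) * (N' : ℤ) ^ (a - j) := by
      rw [hB, ← Finset.add_sum_Ioc_eq_sum_Icc hba.le, Finset.mul_sum]
      congr 1
      · simp
      · refine Finset.sum_congr rfl fun j hj => ?_
        rw [Finset.mem_Ioc] at hj
        have : (n' : ℤ) ^ (j - b) = n' * (n' : ℤ) ^ (j - b - 1) := by
          rw [← pow_succ']; congr 1; omega
        rw [this]; ring
    rw [hB2]
    apply IsCoprime.add_mul_left_right
    apply IsCoprime.mul_right
    · apply IsCoprime.symm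
      rcases (abs_eq (zero_le_one)).1 hαb with h | h <;> rw [h]
      · exact isCoprime_one_left
      · exact isCoprime_one_left.neg_left
    · exact IsCoprime.pow_right (Nat.isCoprime_iff_coprime.2 hco)
  have h6 : Nat.Coprime (n' ^ b) B.natAbs := by
    apply Nat.Coprime.pow_left
    rw [Int.isCoprime_iff_gcd_eq_one] at h5
    simpa [Int.gcd] using h5
  obtain ⟨t, ht⟩ := exists_eq_pow_of_mul_eq_pow (a := n' ^ b) (b := B.natAbs) (c := m') (k := a)
    (by rw [Nat.isUnit_iff]; exact h6) h4
  obtain ⟨c, hc, -⟩ := Nat.exists_eq_pow_of_exponent_coprime_of_pow_eq_pow hcop.symm ht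
  refine ⟨d, c, Nat.gcd_dvd_right n N, ?_⟩
  rw [← hc, mul_comm]
  exact hn'

lemma count_bad (a : ℕ) (ha : 2 ≤ a) (ε : ℝ) (hε : 0 < ε) :
    ∃ N₀ : ℕ, ∀ N : ℕ, N₀ < N → ∀ S : Finset ℕ,
      (∀ n ∈ S, 0 < n ∧ n ≤ N ∧ ∃ d t : ℕ, d ∣ N ∧ n = d * t ^ a) → (S.card : ℝ) ≤ ε * N := by
  obtain ⟨K, hK⟩ := exists_nat_gt (32 / ε)
  obtain ⟨W, hW⟩ := exists_nat_gt (24 * (K : ℝ) ^ 2 / ε)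
  refine ⟨(W + 1) ^ 4, fun N hN S hS => ?_⟩
  have hKpos : (0 : ℝ) < K := lt_trans (by positivity) hK
  have hKn : 0 < K := by exact_mod_cast hKpos
  set w := Nat.sqrt (Nat.sqrt N) with hw
  have hw1 : w ^ 4 ≤ N := by
    have e1 := Nat.sqrt_le' N
    have e2 := Nat.sqrt_le' (Nat.sqrt N)
    calc w ^ 4 = (w ^ 2) ^ 2 := by ring
      _ ≤ (Nat.sqrt N) ^ 2 := Nat.pow_le_pow_left e2 2
      _ ≤ N := e1
  have hw2 : N < (w + 1) ^ 4 := by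
    have e1 := Nat.lt_succ_sqrt' N
    have e2 := Nat.lt_succ_sqrt' (Nat.sqrt N)
    calc N < (Nat.sqrt N + 1) ^ 2 := e1
      _ ≤ ((w + 1) ^ 2) ^ 2 := Nat.pow_le_pow_left e2 2
      _ = _ := by ring
  have hwW : W < w := by
    by_contra hcon
    push Not at hcon
    have : (w + 1) ^ 4 ≤ (W + 1) ^ 4 := Nat.pow_le_pow_left (by omega) 4
    omega
  have hsub : S ⊆ ((Finset.range ((w + 1) ^ 2 / K + 1) ×ˢ Finset.range ((w + 1) ^ 2)).image
        (fun x : ℕ × ℕ => x.1 * x.2 ^ a)) ∪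
      ((Finset.range ((w + 1) ^ 2 * K) ×ˢ Finset.range ((w + 1) * K)).image
        (fun x : ℕ × ℕ => (N / x.1) * x.2 ^ a)) := by
    intro n hn
    obtain ⟨hn0, hnN, d, t, ⟨e, he⟩, hdt⟩ := hS n hn
    have hd0 : 0 < d := by
      rcases Nat.eq_zero_or_pos d with h | h
      · subst h; simp at hdt; omega
      · exact h
    have ht0 : 0 < t := by
      rcases Nat.eq_zero_or_pos t with h | h
      · subst h; rw [zero_pow (by omega)] at hdt; omega
      · exact h
    have hta : t ^ a ≤ e := by
      have : d * t ^ a ≤ d * e := by omega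
      exact Nat.le_of_mul_le_mul_left this hd0
    have ht2 : t ^ 2 ≤ e := le_trans (Nat.pow_le_pow_right ht0 ha) hta
    have heN : e ≤ N := by rw [he]; exact Nat.le_mul_of_pos_left _ hd0
    have he0 : 0 < e := lt_of_lt_of_le (by positivity) ht2
    rw [Finset.mem_union, Finset.mem_image, Finset.mem_image]
    by_cases hcase : d * K ≤ (w + 1) ^ 2
    · left
      refine ⟨(d, t), ?_, hdt.symm⟩
      rw [Finset.mem_product, Finset.mem_range, Finset.mem_range]
      refine ⟨Nat.lt_succ_of_le ((Nat.le_div_iff_mul_le hKn).2 hcase), ?_⟩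
      have : t ^ 2 < ((w + 1) ^ 2) ^ 2 := by
        calc t ^ 2 ≤ N := ht2.trans heN
          _ < (w + 1) ^ 4 := hw2
          _ = _ := by ring
      exact lt_of_pow_lt_pow_left₀ 2 (by positivity) this
    · right
      push Not at hcase
      refine ⟨(e, t), ?_, ?_⟩
      · rw [Finset.mem_product, Finset.mem_range, Finset.mem_range]
        have h1 : d * e < d * (d * K ^ 2) := by
          calc d * e = N := he.symm
            _ < (w + 1) ^ 4 := hw2
            _ = ((w + 1) ^ 2) ^ 2 := by ring
            _ ≤ (d * K) ^ 2 := Nat.pow_le_pow_left hcase.le 2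
            _ = _ := by ring
        have h2 : e < d * K ^ 2 := Nat.lt_of_mul_lt_mul_left h1
        have h3 : e < (w + 1) ^ 2 * K := by
          have : e ^ 2 < ((w + 1) ^ 2 * K) ^ 2 := by
            calc e ^ 2 = e * e := by ring
              _ ≤ e * (d * K ^ 2) := Nat.mul_le_mul_left _ h2.le
              _ = N * K ^ 2 := by rw [he]; ring
              _ < (w + 1) ^ 4 * K ^ 2 := Nat.mul_lt_mul_of_pos_right hw2 (by positivity)
              _ = _ := by ring
          exact lt_of_pow_lt_pow_left₀ 2 (by positivity) this
        refine ⟨h3, ?_⟩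
        have : t ^ 2 < ((w + 1) * K) ^ 2 := by
          calc t ^ 2 ≤ e := ht2
            _ < (w + 1) ^ 2 * K := h3
            _ ≤ (w + 1) ^ 2 * K ^ 2 := Nat.mul_le_mul_left _ (Nat.le_self_pow (by norm_num) K)
            _ = _ := by ring
        exact lt_of_pow_lt_pow_left₀ 2 (by positivity) this
      · simp only
        rw [hdt, he, Nat.mul_div_cancel _ he0]
  have hcard : S.card ≤ ((w + 1) ^ 2 / K + 1) * (w + 1) ^ 2 + (w + 1) ^ 2 * K * ((w + 1) * K) := by
    refine (Finset.card_le_card hsub).trans ((Finset.card_union_le _ _).trans ?_)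
    refine add_le_add (Finset.card_image_le.trans ?_) (Finset.card_image_le.trans ?_)
    · simp
    · simp
  have hcR : (S.card : ℝ) ≤ (((w : ℝ) + 1) ^ 2 / K + 1) * ((w : ℝ) + 1) ^ 2
      + ((w : ℝ) + 1) ^ 3 * (K : ℝ) ^ 2 := by
    have h1 : (S.card : ℝ) ≤ (((w + 1) ^ 2 / K : ℕ) + 1 : ℝ) * ((w : ℝ) + 1) ^ 2
        + ((w : ℝ) + 1) ^ 2 * K * (((w : ℝ) + 1) * K) := by exact_mod_cast hcard
    have h2 : (((w + 1) ^ 2 / K : ℕ) : ℝ) ≤ ((w : ℝ) + 1) ^ 2 / K := by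
      refine Nat.cast_div_le.trans ?_
      push_cast; exact le_rfl
    have h3 : (((w + 1) ^ 2 / K : ℕ) + 1 : ℝ) * ((w : ℝ) + 1) ^ 2 ≤
      (((w : ℝ) + 1) ^ 2 / K + 1) * ((w : ℝ) + 1) ^ 2 := by gcongr
    nlinarith
  have hwR : (W : ℝ) < w := by exact_mod_cast hwW
  have hw_one : (1 : ℝ) ≤ w := by
    have : 1 ≤ w := by omega
    exact_mod_cast this
  have hK1 : (1 : ℝ) ≤ K := by exact_mod_cast hKn
  have g1 : ((w : ℝ) + 1) ≤ 2 * w := by linarith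
  have g2 : ((w : ℝ) + 1) ^ 2 ≤ 4 * w ^ 2 := by
    calc ((w : ℝ) + 1) ^ 2 ≤ (2 * w) ^ 2 := by gcongr
      _ = _ := by ring
  have g3 : ((w : ℝ) + 1) ^ 3 ≤ 8 * w ^ 3 := by
    calc ((w : ℝ) + 1) ^ 3 ≤ (2 * w) ^ 3 := by gcongr
      _ = _ := by ring
  have i1 : 16 / (K : ℝ) ≤ ε / 2 := by
    rw [div_lt_iff₀ hε] at hK
    rw [div_le_div_iff₀ hKpos (by norm_num)]
    linarith
  have i2 : 12 * (K : ℝ) ^ 2 ≤ ε / 2 * w := by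
    rw [div_lt_iff₀ hε] at hW
    nlinarith
  have hwN : (w : ℝ) ^ 4 ≤ N := by exact_mod_cast hw1
  calc (S.card : ℝ) ≤ _ := hcR
    _ ≤ (4 * (w : ℝ) ^ 2 / K + 1) * (4 * (w : ℝ) ^ 2) + 8 * w ^ 3 * (K : ℝ) ^ 2 := by gcongr
    _ = 16 / K * (w : ℝ) ^ 4 + (4 * (w : ℝ) ^ 2 * 1 * 1 + 8 * w ^ 3 * (K : ℝ) ^ 2) := by ring
    _ ≤ 16 / K * (w : ℝ) ^ 4 + (4 * (w : ℝ) ^ 2 * w * (K : ℝ) ^ 2 + 8 * w ^ 3 * (K : ℝ) ^ 2) := by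
        have : (1 : ℝ) ≤ (K : ℝ) ^ 2 := one_le_pow₀ hK1
        gcongr
    _ = 16 / K * (w : ℝ) ^ 4 + 12 * (K : ℝ) ^ 2 * w ^ 3 := by ring
    _ ≤ ε / 2 * (w : ℝ) ^ 4 + ε / 2 * w * w ^ 3 := by gcongr
    _ = ε * (w : ℝ) ^ 4 := by ring
    _ ≤ ε * N := by gcongr

set_option maxHeartbeats 2000000

/-- Exploding differences for "fractionally related" polynomials
(Corollary 3.6 of the paper). -/
theorem fractionally_related_exploding_differences
    (qq pp : Polynomial (Polynomial ℕ)) (k : ℕ) (hk : 1 < k)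
    (hdq : diagDeg qq = k) (hdp : diagDeg pp = k)
    (hqn : 0 < qq.natDegree) (hpn : 0 < pp.natDegree)
    (hQk : (homComp qq k).natDegree ≠ 0) (hPk : (homComp pp k).natDegree ≠ 0)
    (h0 : (homComp qq k).eval 0 ≤ (homComp pp k).eval 0)
    -- γ = Q_k^{-1} ∘ P_k on [0,∞)
    (γ : ℝ → ℝ) (hγ0 : ∀ y : ℝ, 0 ≤ y → 0 ≤ γ y)
    (hγ : ∀ y : ℝ, 0 ≤ y → (homComp qq k).eval (γ y) = (homComp pp k).eval y)
    -- R_k ≡ 0 on [0,1]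
    (hR0 : ∀ y ∈ Set.Icc (0 : ℝ) 1,
      ((homComp pp (k - 1)).eval y - (homComp qq (k - 1)).eval (γ y))
        / ((homComp qq k).derivative.eval (γ y)) = 0)
    -- γ_k(y)^a = Σ_{j=b}^a α_j y^j
    (a b : ℕ) (hb : 1 ≤ b) (hba : b < a) (hcop : Nat.Coprime a b)
    (α : ℕ → ℤ) (hαb : |α b| = 1)
    (hγa : ∀ y ∈ Set.Icc (0 : ℝ) 1,
      γ y ^ a = ∑ j ∈ Finset.Icc b a, (α j : ℝ) * y ^ j)
    -- C_u ≡ 0 on [0,1] for 2 ≤ u ≤ s, and a < s ≤ k−1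
    (s : ℕ) (hsk : s ≤ k - 1)
    (hC0 : ∀ u : ℕ, 2 ≤ u → u ≤ s → ∀ y ∈ Set.Icc (0 : ℝ) 1,
      ((homComp qq (k - u)).eval (γ y) - (homComp pp (k - u)).eval y)
        / ((homComp qq k).derivative.eval (γ y)) = 0)
    (has : a < s) :
    ExplodingDiff (bEval qq) (bEval pp) := by
  classical
  intro δ hδ hδ1
  have ha2 : 2 ≤ a := by omega
  obtain ⟨c, hc, hlow⟩ := homComp_lower qq k hQk δ hδ
  obtain ⟨N₁, hN₁⟩ := count_bad a ha2 δ hδ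
  set A : ℝ := 1 + ∑ j ∈ Finset.Icc b a, |(α j : ℝ)| with hA
  have hA1 : 1 ≤ A := by
    have : 0 ≤ ∑ j ∈ Finset.Icc b a, |(α j : ℝ)| := Finset.sum_nonneg fun _ _ => abs_nonneg _
    linarith
  have hA0 : 0 < A := by linarith
  set E : ℝ := ∑ j ∈ Finset.range (k + 1), ((homComp qq j).eval 1 + (homComp pp j).eval 1) with hE
  have hE0 : 0 ≤ E := Finset.sum_nonneg fun j _ =>
    add_nonneg (homComp_nonneg qq j zero_le_one) (homComp_nonneg pp j zero_le_one)
  have haR : (0 : ℝ) < a := by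
    have : 0 < a := by omega
    exact_mod_cast this
  set cc : ℝ := c / (a * A ^ (a - 1)) with hcc
  have hcc_pos : 0 < cc := by positivity
  obtain ⟨N₂, hN₂⟩ := exists_nat_gt (2 * E / cc)
  refine ⟨cc / 2, by positivity, N₁ + N₂,
    fun N => if N₁ < N then (Finset.Icc 1 N).filter (fun n => ∃ d t : ℕ, d ∣ N ∧ n = d * t ^ a)
      else ∅, ?_, ?_, ?_⟩
  · intro N
    beta_reduce
    by_cases h : N₁ < N
    · rw [if_pos h]
      apply hN₁ N h
      intro n hn
      rw [Finset.mem_filter, Finset.mem_Icc] at hn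
      exact ⟨by omega, by omega, hn.2⟩
    · rw [if_neg h]
      simp only [Finset.card_empty, Nat.cast_zero]
      positivity
  · intro N n hn
    beta_reduce at hn
    by_cases h : N₁ < N
    · rw [if_pos h, Finset.mem_coe, Finset.mem_filter, Finset.mem_Icc] at hn
      exact hn.1
    · rw [if_neg h] at hn
      simp at hn
  intro N hN n hnδ hnN hnΓ m hmδ hmN
  beta_reduce at hnΓ
  rw [if_pos (by omega), Finset.mem_filter, Finset.mem_Icc] at hnΓ
  have hNpos : 0 < N := by omega
  have hNR : (0 : ℝ) < N := by exact_mod_cast hNpos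
  have hN1 : (1 : ℝ) ≤ N := by exact_mod_cast hNpos
  have hnpos : 0 < n := by
    have : (0 : ℝ) < n := lt_of_lt_of_le (by positivity) hnδ
    exact_mod_cast this
  set x : ℝ := (m : ℝ) / N with hx
  set y : ℝ := (n : ℝ) / N with hy
  have hxδ : δ ≤ x := by rw [hx, le_div_iff₀ hNR]; exact hmδ
  have hyδ : δ ≤ y := by rw [hy, le_div_iff₀ hNR]; exact hnδ
  have hx1 : x ≤ 1 := by rw [hx, div_le_one hNR]; exact_mod_cast hmN
  have hy1 : y ≤ 1 := by rw [hy, div_le_one hNR]; exact_mod_cast hnN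
  have hx0 : 0 < x := lt_of_lt_of_le hδ hxδ
  have hy0 : 0 < y := lt_of_lt_of_le hδ hyδ
  have hyI : y ∈ Set.Icc (0 : ℝ) 1 := ⟨hy0.le, hy1⟩
  set g : ℝ := γ y with hg
  have hg0 : 0 ≤ g := hγ0 y hy0.le
  have hgpos : 0 < g := by
    rcases hg0.lt_or_eq with h | h
    · exact h
    · exfalso
      obtain ⟨c₁, hc₁, hl⟩ := homComp_lower pp k hPk y hy0
      have e1 := hl 0 y le_rfl hy0.le le_rfl
      have e2 := hγ y hy0.le
      rw [← hg, ← h] at e2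
      have : 0 < c₁ * (y - 0) := by rw [sub_zero]; positivity
      linarith
  have hder : (homComp qq k).derivative.eval g ≠ 0 := (homComp_deriv_pos qq k hQk g hgpos).ne'
  have hPQ : ∀ j ∈ Finset.Ico (k - s) (k + 1), (homComp pp j).eval y = (homComp qq j).eval g := by
    intro j hj
    rw [Finset.mem_Ico] at hj
    obtain ⟨u, hu⟩ : ∃ u, u = k - j := ⟨_, rfl⟩
    have hj' : j = k - u := by omega
    rcases Nat.lt_or_ge u 2 with h2 | h2
    · rcases (by omega : u = 0 ∨ u = 1) with h | h
      · rw [hj', h, Nat.sub_zero]; exact (hγ y hy0.le).symm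
      · rw [hj', h]
        have := hR0 y hyI
        rw [div_eq_zero_iff] at this
        rcases this with h | h
        · linarith
        · exact absurd h hder
    · rw [hj']
      have := hC0 u h2 (by omega) y hyI
      rw [div_eq_zero_iff] at this
      rcases this with h | h
      · linarith
      · exact absurd h hder
  -- bounds on γ
  have hga : g ^ a = ∑ j ∈ Finset.Icc b a, (α j : ℝ) * y ^ j := hγa y hyI
  have hgA : g ≤ A := by
    by_contra hcon
    push Not at hcon
    have h1 : g ≤ g ^ a := le_self_pow₀ (by linarith) (by omega)
    have h2 : g ^ a ≤ ∑ j ∈ Finset.Icc b a, |(α j : ℝ)| := by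
      rw [hga]
      refine Finset.sum_le_sum fun j _ => ?_
      calc (α j : ℝ) * y ^ j ≤ |(α j : ℝ)| * y ^ j := by
            gcongr; exact le_abs_self _
        _ ≤ |(α j : ℝ)| * 1 := by
            gcongr; exact pow_le_one₀ hy0.le hy1
        _ = _ := mul_one _
    linarith
  set Z : ℤ := ∑ j ∈ Finset.Icc b a, α j * (n : ℤ) ^ j * (N : ℤ) ^ (a - j) with hZ
  have hZg : (Z : ℝ) = (N : ℝ) ^ a * g ^ a := by
    rw [hga, hZ, Finset.mul_sum]
    push_cast
    refine Finset.sum_congr rfl fun j hj => ?_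
    rw [Finset.mem_Icc] at hj
    have : (N : ℝ) ^ a = (N : ℝ) ^ j * (N : ℝ) ^ (a - j) := by
      rw [← pow_add]; congr 1; omega
    rw [this, hy, div_pow]
    field_simp
  have hmx : (m : ℝ) ^ a = (N : ℝ) ^ a * x ^ a := by
    rw [hx, div_pow]; field_simp
  have hne : (m : ℤ) ^ a - Z ≠ 0 := by
    intro h
    apply hnΓ
    exact ⟨⟨hnpos, hnN⟩, perfect_power a b hba hcop α hαb m n N hnpos (sub_eq_zero.1 h)⟩
  have h1 : (1 : ℝ) ≤ (N : ℝ) ^ a * |x ^ a - g ^ a| := by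
    have : (1 : ℤ) ≤ |(m : ℤ) ^ a - Z| := Int.one_le_abs hne
    have h2 : (1 : ℝ) ≤ |(m : ℝ) ^ a - (Z : ℝ)| := by exact_mod_cast this
    rw [hmx, hZg, ← mul_sub, abs_mul, abs_of_pos (by positivity : (0 : ℝ) < (N : ℝ) ^ a)] at h2
    exact h2
  have h2 : |x ^ a - g ^ a| ≤ |x - g| * a * A ^ (a - 1) := by
    refine (abs_pow_sub_pow_le ..).trans ?_
    gcongr
    rw [abs_of_pos hx0, abs_of_pos hgpos]
    exact max_le (hx1.trans hA1) hgA
  have h3 : cc ≤ (N : ℝ) ^ a * (c * |x - g|) := by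
    rw [hcc, div_le_iff₀ (by positivity)]
    have h4 : (1 : ℝ) ≤ (N : ℝ) ^ a * (|x - g| * a * A ^ (a - 1)) := h1.trans (by gcongr)
    calc c = c * 1 := (mul_one c).symm
      _ ≤ c * ((N : ℝ) ^ a * (|x - g| * a * A ^ (a - 1))) := by gcongr
      _ = _ := by ring
  -- the main term
  have hmain : (N : ℝ) ^ k * (c * |x - g|) ≤ |∑ j ∈ Finset.Ico (k - s) (k + 1),
      (N : ℝ) ^ j * ((homComp qq j).eval x - (homComp qq j).eval g)| := by
    have hkm : k ∈ Finset.Ico (k - s) (k + 1) := by rw [Finset.mem_Ico]; omega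
    rcases le_total g x with h | h
    · refine le_trans ?_ (le_abs_self _)
      rw [abs_of_nonneg (sub_nonneg.2 h)]
      refine le_trans (mul_le_mul_of_nonneg_left (hlow g x hg0 h hxδ) (by positivity)) ?_
      exact Finset.single_le_sum (f := fun j => (N : ℝ) ^ j *
        ((homComp qq j).eval x - (homComp qq j).eval g))
        (fun j _ => mul_nonneg (by positivity) (sub_nonneg.2 (homComp_mono qq j hg0 h))) hkm
    · refine le_trans ?_ (neg_le_abs _)
      rw [abs_sub_comm, abs_of_nonneg (sub_nonneg.2 h), ← Finset.sum_neg_distrib]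
      refine le_trans (mul_le_mul_of_nonneg_left (hlow x g hx0.le h (hxδ.trans h))
        (by positivity)) ?_
      have e : ∀ j, -((N : ℝ) ^ j * ((homComp qq j).eval x - (homComp qq j).eval g))
        = (N : ℝ) ^ j * ((homComp qq j).eval g - (homComp qq j).eval x) := fun j => by ring
      simp only [e]
      exact Finset.single_le_sum (f := fun j => (N : ℝ) ^ j *
        ((homComp qq j).eval g - (homComp qq j).eval x))
        (fun j _ => mul_nonneg (by positivity) (sub_nonneg.2 (homComp_mono qq j hx0.le h))) hkm
  -- the error term
  have herr : |∑ j ∈ Finset.range (k - s),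
      (N : ℝ) ^ j * ((homComp qq j).eval x - (homComp pp j).eval y)| ≤ E * (N : ℝ) ^ (k - s - 1) := by
    refine (Finset.abs_sum_le_sum_abs _ _).trans ?_
    calc _ ≤ ∑ j ∈ Finset.range (k - s),
          ((homComp qq j).eval 1 + (homComp pp j).eval 1) * (N : ℝ) ^ (k - s - 1) := by
          refine Finset.sum_le_sum fun j hj => ?_
          rw [Finset.mem_range] at hj
          rw [abs_mul, abs_of_pos (by positivity : (0 : ℝ) < (N : ℝ) ^ j), mul_comm]
          have q0 := homComp_nonneg qq j hx0.le
          have p0 := homComp_nonneg pp j hy0.le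
          have q1 := homComp_mono qq j hx0.le hx1
          have p1 := homComp_mono pp j hy0.le hy1
          apply mul_le_mul _ (pow_le_pow_right₀ hN1 (by omega)) (by positivity) (by linarith)
          rw [abs_le]; constructor <;> linarith
      _ = (∑ j ∈ Finset.range (k - s),
          ((homComp qq j).eval 1 + (homComp pp j).eval 1)) * (N : ℝ) ^ (k - s - 1) := by
          rw [Finset.sum_mul]
      _ ≤ _ := by
          apply mul_le_mul_of_nonneg_right _ (by positivity)
          rw [hE]
          apply Finset.sum_le_sum_of_subset_of_nonneg
          · intro j hj
            rw [Finset.mem_range] at hj ⊢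
            omega
          · intro j _ _
            exact add_nonneg (homComp_nonneg qq j zero_le_one) (homComp_nonneg pp j zero_le_one)
  have hdiff : (bEval qq m N : ℝ) - (bEval pp n N : ℝ) =
      (∑ j ∈ Finset.Ico (k - s) (k + 1),
        (N : ℝ) ^ j * ((homComp qq j).eval x - (homComp qq j).eval g)) +
      ∑ j ∈ Finset.range (k - s),
        (N : ℝ) ^ j * ((homComp qq j).eval x - (homComp pp j).eval y) := by
    rw [bEval_eq qq k hdq m N hNpos, bEval_eq pp k hdp n N hNpos, ← Finset.sum_sub_distrib,
      ← Finset.sum_range_add_sum_Ico _ (by omega : k - s ≤ k + 1), add_comm]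
    congr 1
    · refine Finset.sum_congr rfl fun j hj => ?_
      rw [← hPQ j hj]; ring
    · refine Finset.sum_congr rfl fun j _ => ?_
      ring
  rw [hdiff]
  have hfin := abs_sub_abs_le_abs_add (∑ j ∈ Finset.Ico (k - s) (k + 1),
        (N : ℝ) ^ j * ((homComp qq j).eval x - (homComp qq j).eval g)) (∑ j ∈ Finset.range (k - s),
        (N : ℝ) ^ j * ((homComp qq j).eval x - (homComp pp j).eval y))
  have hm2 : cc * (N : ℝ) ^ (k - a) ≤ (N : ℝ) ^ k * (c * |x - g|) := by
    have : (N : ℝ) ^ k = (N : ℝ) ^ a * (N : ℝ) ^ (k - a) := by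
      rw [← pow_add]; congr 1; omega
    rw [this]
    calc cc * (N : ℝ) ^ (k - a) ≤ (N : ℝ) ^ a * (c * |x - g|) * (N : ℝ) ^ (k - a) := by gcongr
      _ = _ := by ring
  have he2 : E * (N : ℝ) ^ (k - s - 1) ≤ cc / 2 * (N : ℝ) ^ (k - a) := by
    have hEN : E ≤ cc / 2 * N := by
      rw [div_lt_iff₀ hcc_pos] at hN₂
      have : (N₂ : ℝ) ≤ N := by
        have : N₂ ≤ N := by omega
        exact_mod_cast this
      nlinarith
    calc E * (N : ℝ) ^ (k - s - 1) ≤ cc / 2 * N * (N : ℝ) ^ (k - s - 1) := by gcongr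
      _ = cc / 2 * (N : ℝ) ^ (k - s - 1 + 1) := by ring
      _ ≤ _ := by
        apply mul_le_mul_of_nonneg_left _ (by positivity)
        exact pow_le_pow_right₀ hN1 (by omega)
  have hN3 : (N : ℝ) ≤ (N : ℝ) ^ (k - a) := le_self_pow₀ hN1 (by omega)
  have hN4 : cc / 2 * N ≤ cc / 2 * (N : ℝ) ^ (k - a) := by gcongr
  linarith
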